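/- Let e, κ, v > 0. There is no C¹ solution (ψ, N) : ℝ → ℝ² of the Chern–Simons BPS system ψ' = ∓ e N ψ, N' = ∓ ((e/2)ψ² + κN − e v²) (with either fixed choice of sign) satisfying the boundary conditions ψ(x) → −√2 v as x → −∞ and ψ(x) → √2 v as x → +∞. (Any such solution would have ψ(x₀) = 0 at some x₀, and then by uniqueness for the linear ODE ψ' = ∓eN(x)ψ one gets ψ ≡ 0, a contradiction.) -/

import Mathlib

open Filter

/-- A solution of the scalar linear equation `f' = a f` with continuous coefficient is determined
by its value at one point. -/
theorem eq_mul_exp_integral_of_hasDerivAt {a f : ℝ → ℝ} (ha : Continuous a)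
    (hf : ∀ x, HasDerivAt f (a x * f x) x) (x₀ x : ℝ) :
    f x = f x₀ * Real.exp (∫ t in x₀..x, a t) := by
  have hderiv : ∀ y, HasDerivAt (fun y => f y * Real.exp (-∫ t in x₀..y, a t)) 0 y := by
    intro y
    have hA : HasDerivAt (fun y => ∫ t in x₀..y, a t) (a y) y :=
      (ha.integral_hasStrictDerivAt x₀ y).hasDerivAt
    exact ((hf y).mul hA.neg.exp).congr_deriv (by ring)
  have hconst := is_const_of_deriv_eq_zero (fun y => (hderiv y).differentiableAt)
    (fun y => (hderiv y).deriv) x x₀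
  simp only [intervalIntegral.integral_same, neg_zero, Real.exp_zero, mul_one] at hconst
  rw [← hconst, mul_assoc, ← Real.exp_add, neg_add_cancel, Real.exp_zero, mul_one]

/-- The Chern–Simons BPS system `ψ' = ∓eNψ`, `N' = ∓((e/2)ψ² + κN − ev²)`
(for either fixed choice of sign, encoded by `ε ∈ {1, -1}`) admits no `C¹` solution with
`ψ(-∞) = -√2 v` and `ψ(+∞) = √2 v`. -/
theorem chern_simons_no_bps_wall (e κ v : ℝ) (he : 0 < e) (hκ : 0 < κ) (hv : 0 < v)
    (ε : ℝ) (hε : ε = 1 ∨ ε = -1) :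
    ¬ ∃ ψ N : ℝ → ℝ, ContDiff ℝ 1 ψ ∧ ContDiff ℝ 1 N ∧
      (∀ x : ℝ, deriv ψ x = ε * (e * N x * ψ x)) ∧
      (∀ x : ℝ, deriv N x = ε * (e / 2 * (ψ x) ^ 2 + κ * N x - e * v ^ 2)) ∧
      Tendsto ψ atBot (nhds (-(Real.sqrt 2 * v))) ∧
      Tendsto ψ atTop (nhds (Real.sqrt 2 * v)) := by
  rintro ⟨ψ, N, hψ, hN, hψ', -, hbot, htop⟩
  have hpos : 0 < Real.sqrt 2 * v := by positivity
  obtain ⟨a, ha⟩ := (hbot.eventually_lt_const (neg_neg_of_pos hpos)).exists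
  obtain ⟨b, hb⟩ := (htop.eventually_const_lt hpos).exists
  have hsol : ∀ x, HasDerivAt ψ (ε * e * N x * ψ x) x := by
    intro x
    have h := (hψ.differentiable one_ne_zero x).hasDerivAt
    exact h.congr_deriv (by rw [hψ' x]; ring)
  have h := eq_mul_exp_integral_of_hasDerivAt (continuous_const.mul hN.continuous) hsol a b
  exact (h.trans_lt (mul_neg_of_neg_of_pos ha (Real.exp_pos _))).not_gt hb
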